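/- Let (f,g,ρ) be a warped Berger solution of Ricci flow on S^1×S^3 defined on [0,T) such that at t = 0 one has f ≤ g and (min_ξ R(ξ,0))·(max_ξ g(ξ,0)²) > −3. Suppose T < ∞ and the Ricci curvature blows up at time T, i.e. limsup_{t↗T} max_ξ (|κ_{01}+2κ_{12}| + |κ_{01}+2κ_{02}| + |κ_{02}+κ_{12}+κ_{23}|)(ξ,t) = ∞. Then liminf_{t↗T} M̌(t) = 0, and there exists a uniform constant C < ∞ such that the mixed sectional curvatures satisfy |κ_{01}(ξ,t)| + 2|κ_{02}(ξ,t)| ≤ C/M̌(t)² for all (ξ,t) ∈ S^1×[0,T). -/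

import Mathlib

open Real Set Filter Topology

noncomputable section

/-- Partial derivative in the first (spatial, `ξ`) variable. -/
def pd1 (φ : ℝ → ℝ → ℝ) (ξ t : ℝ) : ℝ := deriv (fun x => φ x t) ξ

/-- Partial derivative in the second (time) variable: `φ_t`. -/
def pdt (φ : ℝ → ℝ → ℝ) (ξ t : ℝ) : ℝ := deriv (fun τ => φ ξ τ) t

/-- Derivative with respect to arclength `s` (where `ds = ρ dξ`): `φ_s := ρ⁻¹ ∂_ξ φ`. -/
def Ds (ρ φ : ℝ → ℝ → ℝ) (ξ t : ℝ) : ℝ := pd1 φ ξ t / ρ ξ t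

/-- Sectional curvature `κ₁₂ = κ₃₁ = f²/g⁴ − f_s g_s/(f g)`. -/
def k12 (ρ f g : ℝ → ℝ → ℝ) (ξ t : ℝ) : ℝ :=
  (f ξ t) ^ 2 / (g ξ t) ^ 4 - Ds ρ f ξ t * Ds ρ g ξ t / (f ξ t * g ξ t)

/-- Sectional curvature `κ₃₁ = κ₁₂`. -/
def k31 (ρ f g : ℝ → ℝ → ℝ) (ξ t : ℝ) : ℝ :=
  (f ξ t) ^ 2 / (g ξ t) ^ 4 - Ds ρ f ξ t * Ds ρ g ξ t / (f ξ t * g ξ t)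

/-- Sectional curvature `κ₂₃ = (4g² − 3f²)/g⁴ − g_s²/g²`. -/
def k23 (ρ f g : ℝ → ℝ → ℝ) (ξ t : ℝ) : ℝ :=
  (4 * (g ξ t) ^ 2 - 3 * (f ξ t) ^ 2) / (g ξ t) ^ 4 - (Ds ρ g ξ t) ^ 2 / (g ξ t) ^ 2

/-- Sectional curvature `κ₀₁ = −f_ss/f`. -/
def k01 (ρ f : ℝ → ℝ → ℝ) (ξ t : ℝ) : ℝ := -(Ds ρ (Ds ρ f) ξ t) / f ξ t

/-- Sectional curvature `κ₀₂ = κ₀₃ = −g_ss/g`. -/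
def k02 (ρ g : ℝ → ℝ → ℝ) (ξ t : ℝ) : ℝ := -(Ds ρ (Ds ρ g) ξ t) / g ξ t

/-- Scalar curvature `R = κ₀₁ + 2κ₀₂ + 2κ₁₂ + κ₂₃`. -/
def scalR (ρ f g : ℝ → ℝ → ℝ) (ξ t : ℝ) : ℝ :=
  k01 ρ f ξ t + 2 * k02 ρ g ξ t + 2 * k12 ρ f g ξ t + k23 ρ f g ξ t

/-- `M(ξ,t) := min {f(ξ,t), g(ξ,t)}`. -/
def M (f g : ℝ → ℝ → ℝ) (ξ t : ℝ) : ℝ := min (f ξ t) (g ξ t)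

/-- `M̌(t) := min_{ξ ∈ S¹} M(ξ,t)`. -/
def Mcheck (f g : ℝ → ℝ → ℝ) (t : ℝ) : ℝ := ⨅ ξ : ℝ, M f g ξ t

/-- A warped Berger solution of Ricci flow on `S¹ × S³` with (finite) existence time `T`:
smooth positive `2π`-periodic-in-`ξ` functions `f, g, ρ` on `S¹ × [0,T)` satisfying
  `f_t = f_ss + 2 (g_s/g) f_s − 2 f³/g⁴`,
  `g_t = g_ss + (f_s/f + g_s/g) g_s + 2 (f² − 2g²)/g³`,
  `(log ρ)_t = f_ss/f + 2 g_ss/g`. -/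
structure WarpedBerger (T : ℝ) (f g ρ : ℝ → ℝ → ℝ) : Prop where
  T_pos : 0 < T
  f_pos : ∀ ξ t : ℝ, 0 ≤ t → t < T → 0 < f ξ t
  g_pos : ∀ ξ t : ℝ, 0 ≤ t → t < T → 0 < g ξ t
  ρ_pos : ∀ ξ t : ℝ, 0 ≤ t → t < T → 0 < ρ ξ t
  f_per : ∀ ξ t : ℝ, f (ξ + 2 * π) t = f ξ t
  g_per : ∀ ξ t : ℝ, g (ξ + 2 * π) t = g ξ t
  ρ_per : ∀ ξ t : ℝ, ρ (ξ + 2 * π) t = ρ ξ t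
  smooth : ContDiffOn ℝ (⊤ : ℕ∞)
      (fun p : ℝ × ℝ => (f p.1 p.2, g p.1 p.2, ρ p.1 p.2)) (Set.univ ×ˢ Set.Ico 0 T)
  eq_f : ∀ ξ t : ℝ, 0 < t → t < T →
    pdt f ξ t = Ds ρ (Ds ρ f) ξ t + 2 * (Ds ρ g ξ t / g ξ t) * Ds ρ f ξ t
      - 2 * (f ξ t) ^ 3 / (g ξ t) ^ 4
  eq_g : ∀ ξ t : ℝ, 0 < t → t < T →
    pdt g ξ t = Ds ρ (Ds ρ g) ξ t
      + (Ds ρ f ξ t / f ξ t + Ds ρ g ξ t / g ξ t) * Ds ρ g ξ t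
      + 2 * ((f ξ t) ^ 2 - 2 * (g ξ t) ^ 2) / (g ξ t) ^ 3
  eq_ρ : ∀ ξ t : ℝ, 0 < t → t < T →
    pdt (fun x τ => Real.log (ρ x τ)) ξ t
      = Ds ρ (Ds ρ f) ξ t / f ξ t + 2 * (Ds ρ (Ds ρ g) ξ t / g ξ t)

/-- The Ricci curvature blows up as `t ↗ T`:
`limsup_{t↗T} max_ξ (|κ₀₁+2κ₁₂| + |κ₀₁+2κ₀₂| + |κ₀₂+κ₁₂+κ₂₃|) = ∞`, where the three
displayed quantities are the diagonal components of the Ricci tensor. -/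
def RicciBlowup (T : ℝ) (f g ρ : ℝ → ℝ → ℝ) : Prop :=
  ∀ K : ℝ, ∀ t₀ : ℝ, 0 ≤ t₀ → t₀ < T → ∃ ξ t : ℝ, t₀ < t ∧ t < T ∧
    K < |k01 ρ f ξ t + 2 * k12 ρ f g ξ t| + |k01 ρ f ξ t + 2 * k02 ρ g ξ t|
        + |k02 ρ g ξ t + k12 ρ f g ξ t + k23 ρ f g ξ t|

def Sm (T : ℝ) (φ : ℝ → ℝ → ℝ) : Prop :=
  ContDiffOn ℝ (⊤ : ℕ∞) (fun p : ℝ × ℝ => φ p.1 p.2) (Set.univ ×ˢ Set.Ico 0 T)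

lemma udS (T : ℝ) : UniqueDiffOn ℝ ((Set.univ : Set ℝ) ×ˢ Set.Ico 0 T) :=
  uniqueDiffOn_univ.prod (uniqueDiffOn_Ico 0 T)

lemma Sm.hasDx_aux {T : ℝ} {φ : ℝ → ℝ → ℝ} (h : Sm T φ) {ξ t : ℝ} (h0 : 0 ≤ t) (hT : t < T) :
    HasDerivAt (fun z => φ z t)
      (fderivWithin ℝ (fun p : ℝ × ℝ => φ p.1 p.2) (Set.univ ×ˢ Set.Ico 0 T) (ξ, t) (1, 0)) ξ := by
  have hm : (ξ, t) ∈ (Set.univ : Set ℝ) ×ˢ Set.Ico 0 T := ⟨trivial, h0, hT⟩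
  have hd := ((h.differentiableOn (by simp)) (ξ, t) hm).hasFDerivWithinAt
  have hl : HasDerivWithinAt (fun z : ℝ => (z, t)) ((1 : ℝ), (0 : ℝ)) Set.univ ξ :=
    ((hasDerivAt_id ξ).prodMk (hasDerivAt_const ξ t)).hasDerivWithinAt
  have := hd.comp_hasDerivWithinAt (f := fun z : ℝ => (z, t)) ξ hl
    (fun z _ => ⟨trivial, h0, hT⟩)
  exact hasDerivWithinAt_univ.mp this

lemma Sm.hasDx {T : ℝ} {φ : ℝ → ℝ → ℝ} (h : Sm T φ) {ξ t : ℝ} (h0 : 0 ≤ t) (hT : t < T) :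
    HasDerivAt (fun z => φ z t) (pd1 φ ξ t) ξ :=
  (h.hasDx_aux h0 hT).differentiableAt.hasDerivAt

lemma Sm.pd1 {T : ℝ} {φ : ℝ → ℝ → ℝ} (h : Sm T φ) : Sm T (pd1 φ) := by
  have h1 : ContDiffOn ℝ (⊤ : ℕ∞)
      (fderivWithin ℝ (fun p : ℝ × ℝ => φ p.1 p.2) (Set.univ ×ˢ Set.Ico 0 T))
      (Set.univ ×ˢ Set.Ico 0 T) :=
    ContDiffOn.fderivWithin h (udS T) (by simp)
  have h2 := h1.clm_apply (contDiffOn_const (c := ((1 : ℝ), (0 : ℝ))))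
  refine ContDiffOn.congr h2 ?_
  rintro ⟨ξ, t⟩ ⟨_, h0, hT⟩
  exact (h.hasDx_aux h0 hT).deriv

lemma Sm.cda {T : ℝ} {φ : ℝ → ℝ → ℝ} (h : Sm T φ) {ξ t : ℝ} (h0 : 0 < t) (hT : t < T) :
    ContDiffAt ℝ (⊤ : ℕ∞) (fun p : ℝ × ℝ => φ p.1 p.2) (ξ, t) := by
  refine ContDiffOn.contDiffAt h ?_
  exact prod_mem_nhds univ_mem (Ico_mem_nhds h0 hT)

lemma Sm.hasDt_aux {T : ℝ} {φ : ℝ → ℝ → ℝ} (h : Sm T φ) {ξ t : ℝ} (h0 : 0 < t) (hT : t < T) :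
    HasDerivAt (fun τ => φ ξ τ) (fderiv ℝ (fun p : ℝ × ℝ => φ p.1 p.2) (ξ, t) (0, 1)) t := by
  have hd := ((h.cda (ξ := ξ) h0 hT).differentiableAt (by simp)).hasFDerivAt
  have hl : HasDerivAt (fun τ : ℝ => (ξ, τ)) ((0 : ℝ), (1 : ℝ)) t :=
    ((hasDerivAt_const t ξ).prodMk (hasDerivAt_id t))
  exact hd.comp_hasDerivAt (f := fun τ : ℝ => (ξ, τ)) t hl

lemma Sm.hasDx_aux' {T : ℝ} {φ : ℝ → ℝ → ℝ} (h : Sm T φ) {ξ t : ℝ} (h0 : 0 < t) (hT : t < T) :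
    HasDerivAt (fun z => φ z t) (fderiv ℝ (fun p : ℝ × ℝ => φ p.1 p.2) (ξ, t) (1, 0)) ξ := by
  have hd := ((h.cda (ξ := ξ) h0 hT).differentiableAt (by simp)).hasFDerivAt
  have hl : HasDerivAt (fun τ : ℝ => (τ, t)) ((1 : ℝ), (0 : ℝ)) ξ :=
    ((hasDerivAt_id ξ).prodMk (hasDerivAt_const ξ t))
  exact hd.comp_hasDerivAt (f := fun τ : ℝ => (τ, t)) ξ hl

lemma Sm.hasDt {T : ℝ} {φ : ℝ → ℝ → ℝ} (h : Sm T φ) {ξ t : ℝ} (h0 : 0 < t) (hT : t < T) :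
    HasDerivAt (fun τ => φ ξ τ) (pdt φ ξ t) t :=
  (h.hasDt_aux h0 hT).differentiableAt.hasDerivAt

lemma Sm.comm {T : ℝ} {φ : ℝ → ℝ → ℝ} (h : Sm T φ) {ξ t : ℝ} (h0 : 0 < t) (hT : t < T) :
    pdt (_root_.pd1 φ) ξ t = _root_.pd1 (pdt φ) ξ t := by
  set F := fun p : ℝ × ℝ => φ p.1 p.2 with hF
  have hc := h.cda (ξ := ξ) h0 hT
  have hsym : IsSymmSndFDerivAt ℝ F (ξ, t) := hc.isSymmSndFDerivAt (by
    rw [minSmoothness_of_isRCLikeNormedField]; exact WithTop.coe_le_coe.mpr (le_top : (2 : ℕ∞) ≤ ⊤))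
  have hd : HasFDerivAt (fderiv ℝ F) (fderiv ℝ (fderiv ℝ F) (ξ, t)) (ξ, t) :=
    ((hc.fderiv_right (m := 1) (by norm_cast)).differentiableAt (by simp)).hasFDerivAt
  have hl1 : HasDerivAt (fun τ : ℝ => (ξ, τ)) ((0 : ℝ), (1 : ℝ)) t :=
    ((hasDerivAt_const t ξ).prodMk (hasDerivAt_id t))
  have hl2 : HasDerivAt (fun τ : ℝ => (τ, t)) ((1 : ℝ), (0 : ℝ)) ξ :=
    ((hasDerivAt_id ξ).prodMk (hasDerivAt_const ξ t))
  have e1 := (hd.comp_hasDerivAt (f := fun τ : ℝ => (ξ, τ)) t hl1).clm_apply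
    (hasDerivAt_const t ((1 : ℝ), (0 : ℝ)))
  have e2 := (hd.comp_hasDerivAt (f := fun τ : ℝ => (τ, t)) ξ hl2).clm_apply
    (hasDerivAt_const ξ ((0 : ℝ), (1 : ℝ)))
  have a1 : pdt (_root_.pd1 φ) ξ t = fderiv ℝ (fderiv ℝ F) (ξ, t) (0, 1) (1, 0) := by
    have : (fun τ => _root_.pd1 φ ξ τ) =ᶠ[𝓝 t] fun τ => fderiv ℝ F (ξ, τ) (1, 0) := by
      filter_upwards [Ioo_mem_nhds h0 hT] with τ hτ
      exact (h.hasDx_aux' hτ.1 hτ.2).deriv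
    unfold pdt
    rw [this.deriv_eq]
    have := e1.deriv
    simpa [Function.comp_def] using this
  have a2 : _root_.pd1 (pdt φ) ξ t = fderiv ℝ (fderiv ℝ F) (ξ, t) (1, 0) (0, 1) := by
    have : (fun z => pdt φ z t) = fun z => fderiv ℝ F (z, t) (0, 1) := by
      funext z
      exact (h.hasDt_aux h0 hT).deriv
    unfold _root_.pd1
    rw [this]
    have := e2.deriv
    simpa [Function.comp_def] using this
  rw [a1, a2]
  exact hsym (0, 1) (1, 0)

lemma Sm.Ds {T : ℝ} {ρ φ : ℝ → ℝ → ℝ} (hρ : Sm T ρ) (hp : ∀ ξ t : ℝ, 0 ≤ t → t < T → 0 < ρ ξ t)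
    (h : Sm T φ) : Sm T (Ds ρ φ) :=
  ContDiffOn.div h.pd1 hρ (fun p hm => (hp p.1 p.2 hm.2.1 hm.2.2).ne')

lemma hasDs {T : ℝ} {ρ φ : ℝ → ℝ → ℝ} (hp : ∀ ξ t : ℝ, 0 ≤ t → t < T → 0 < ρ ξ t)
    (h : Sm T φ) {ξ t : ℝ} (h0 : 0 ≤ t) (hT : t < T) :
    HasDerivAt (fun z => φ z t) (Ds ρ φ ξ t * ρ ξ t) ξ := by
  have := h.hasDx (ξ := ξ) h0 hT
  convert this using 1
  unfold Ds
  have := (hp ξ t h0 hT).ne'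
  field_simp

lemma Ds_of {ρ φ : ℝ → ℝ → ℝ} {ξ t d : ℝ} (hp : 0 < ρ ξ t)
    (h : HasDerivAt (fun z => φ z t) (d * ρ ξ t) ξ) : Ds ρ φ ξ t = d := by
  unfold Ds pd1
  rw [h.deriv]
  field_simp

/-- commutator -/
lemma pdt_Ds {T : ℝ} {ρ φ : ℝ → ℝ → ℝ} (hρ : Sm T ρ)
    (hp : ∀ ξ t : ℝ, 0 ≤ t → t < T → 0 < ρ ξ t)
    (h : Sm T φ) {ξ t : ℝ} (h0 : 0 < t) (hT : t < T) :
    pdt (Ds ρ φ) ξ t = Ds ρ (pdt φ) ξ t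
      - pdt (fun x τ => Real.log (ρ x τ)) ξ t * Ds ρ φ ξ t := by
  have r := hp ξ t h0.le hT
  have e1 := (h.pd1.hasDt (ξ := ξ) h0 hT).div (hρ.hasDt (ξ := ξ) h0 hT) r.ne'
  have e2 := (hρ.hasDt (ξ := ξ) h0 hT).log r.ne'
  have a1 : pdt (Ds ρ φ) ξ t = _ := e1.deriv
  have a2 : pdt (fun x τ => Real.log (ρ x τ)) ξ t = _ := e2.deriv
  rw [a1, a2, h.comm h0 hT]
  unfold Ds
  field_simp

lemma second_test {φ : ℝ → ℝ} {x : ℝ} (hm : IsLocalMax φ x) (hc : ContinuousAt φ x) :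
    deriv (deriv φ) x ≤ 0 := by
  by_contra hcon
  push Not at hcon
  have hmin := isLocalMin_of_deriv_deriv_pos hcon hm.deriv_eq_zero hc
  have : φ =ᶠ[𝓝 x] fun _ => φ x := by
    filter_upwards [hm, hmin] with z h1 h2
    exact le_antisymm h1 h2
  have h3 := this.deriv.deriv_eq
  simp at h3
  linarith

lemma max_principle {T : ℝ} {ρ φ : ℝ → ℝ → ℝ} (hρ : Sm T ρ)
    (hp : ∀ ξ t : ℝ, 0 ≤ t → t < T → 0 < ρ ξ t)
    (h : Sm T φ) (hper : ∀ ξ t, φ (ξ + 2 * π) t = φ ξ t) (K : ℝ)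
    (hinit : ∀ ξ, φ ξ 0 ≤ K)
    (hev : ∀ ξ t, 0 < t → t < T → K < φ ξ t → Ds ρ φ ξ t = 0 →
      Ds ρ (Ds ρ φ) ξ t ≤ 0 → pdt φ ξ t ≤ 0) :
    ∀ ξ t, 0 ≤ t → t < T → φ ξ t ≤ K := by
  intro ξ₁ t₁ h01 hT1
  by_contra hcon
  push Not at hcon
  have ht1 : 0 < t₁ := by
    rcases h01.eq_or_lt with h | h
    · rw [← h] at hcon; exact absurd (hinit ξ₁) (not_le.mpr hcon)
    · exact h
  set ε := (φ ξ₁ t₁ - K) / (2 * t₁) with hε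
  have hεp : 0 < ε := by rw [hε]; apply div_pos <;> linarith
  have hεt : ε * t₁ = (φ ξ₁ t₁ - K) / 2 := by rw [hε]; field_simp
  have pp : (0 : ℝ) < 2 * π := by positivity
  have hcomp : IsCompact (Set.Icc (0 : ℝ) (2 * π) ×ˢ Set.Icc (0 : ℝ) t₁) :=
    isCompact_Icc.prod isCompact_Icc
  have hcont : ContinuousOn (fun p : ℝ × ℝ => φ p.1 p.2 - ε * p.2)
      (Set.Icc (0 : ℝ) (2 * π) ×ˢ Set.Icc (0 : ℝ) t₁) := by
    apply ContinuousOn.sub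
    · exact h.continuousOn.mono (fun p hm => ⟨trivial, hm.2.1, lt_of_le_of_lt hm.2.2 hT1⟩)
    · fun_prop
  obtain ⟨⟨a, b⟩, ⟨ha, hb⟩, hmax⟩ := hcomp.exists_isMaxOn
    ⟨(0, 0), ⟨⟨le_refl _, pp.le⟩, ⟨le_refl _, h01⟩⟩⟩ hcont
  have hmax' : ∀ z τ, 0 ≤ τ → τ ≤ t₁ → φ z τ - ε * τ ≤ φ a b - ε * b := by
    intro z τ hτ0 hτ1
    have hP : Function.Periodic (fun z => φ z τ) (2 * π) := fun z => hper z τ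
    obtain ⟨y, hy, hyz⟩ := hP.exists_mem_Ico₀ pp z
    have := hmax (show (y, τ) ∈ Set.Icc (0 : ℝ) (2 * π) ×ˢ Set.Icc (0 : ℝ) t₁ from
      ⟨⟨hy.1, hy.2.le⟩, hτ0, hτ1⟩)
    have hyz' : φ z τ = φ y τ := hyz
    rw [hyz']; exact this
  simp only at ha hb
  have h1 := hmax' ξ₁ t₁ h01 le_rfl
  have hb0 : 0 < b := by
    rcases hb.1.eq_or_lt with h | h
    · rw [← h] at h1
      have := hinit a
      nlinarith
    · exact h
  have hbT : b < T := lt_of_le_of_lt hb.2 hT1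
  have hgt : K < φ a b := by nlinarith
  have hloc : IsLocalMax (fun z => φ z b) a := by
    filter_upwards with z
    have := hmax' z b hb.1 hb.2
    linarith
  have hd1 : pd1 φ a b = 0 := hloc.deriv_eq_zero
  have hd2 : pd1 (pd1 φ) a b ≤ 0 := second_test hloc (h.hasDx hb.1 hbT).continuousAt
  have r := hp a b hb.1 hbT
  have hD1 : Ds ρ φ a b = 0 := by unfold Ds; rw [hd1]; simp
  have hD2 : Ds ρ (Ds ρ φ) a b ≤ 0 := by
    have e : HasDerivAt (fun z => Ds ρ φ z b) _ a :=
      (h.pd1.hasDx (ξ := a) hb.1 hbT).div (hρ.hasDx (ξ := a) hb.1 hbT) r.ne'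
    have e' : pd1 (Ds ρ φ) a b = _ := e.deriv
    have : Ds ρ (Ds ρ φ) a b = pd1 (pd1 φ) a b / (ρ a b) ^ 2 := by
      rw [show Ds ρ (Ds ρ φ) a b = pd1 (Ds ρ φ) a b / ρ a b from rfl, e', hd1]
      field_simp
      ring
    rw [this]
    exact div_nonpos_of_nonpos_of_nonneg hd2 (by positivity)
  have hfin := hev a b hb0 hbT hgt hD1 hD2
  have hdt := h.hasDt (ξ := a) hb0 hbT
  -- slope from the left
  have hmono : ε ≤ pdt φ a b := by
    have hs := hdt.tendsto_slope
    have hs' : Tendsto (slope (fun τ => φ a τ) b) (𝓝[<] b) (𝓝 (pdt φ a b)) :=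
      hs.mono_left (nhdsWithin_mono _ (fun z hz => ne_of_lt hz))
    refine ge_of_tendsto hs' ?_
    filter_upwards [Ioo_mem_nhdsLT hb0] with τ hτ
    have := hmax' a τ hτ.1.le (hτ.2.le.trans hb.2)
    rw [slope_def_field, le_div_iff_of_neg (by linarith [hτ.2])]
    nlinarith
  linarith

lemma Ds_per {ρ φ : ℝ → ℝ → ℝ} (hρ : ∀ ξ t, ρ (ξ + 2 * π) t = ρ ξ t)
    (h : ∀ ξ t, φ (ξ + 2 * π) t = φ ξ t) : ∀ ξ t, Ds ρ φ (ξ + 2 * π) t = Ds ρ φ ξ t := by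
  intro ξ t
  unfold Ds pd1
  rw [hρ, ← deriv_comp_add_const]
  simp only [h]

lemma bdd_init {T : ℝ} (hT : 0 < T) {φ : ℝ → ℝ → ℝ} (h : Sm T φ)
    (hper : ∀ ξ t, φ (ξ + 2 * π) t = φ ξ t) : ∃ K, ∀ ξ, φ ξ 0 ≤ K := by
  have hc : Continuous (fun z => φ z 0) :=
    continuous_iff_continuousAt.mpr (fun z => (h.hasDx le_rfl hT).continuousAt)
  have pp : (0 : ℝ) < 2 * π := by positivity
  obtain ⟨K, hK⟩ := (isCompact_Icc (a := (0 : ℝ)) (b := 2 * π)).bddAbove_image hc.continuousOn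
  refine ⟨K, fun ξ => ?_⟩
  have hP : Function.Periodic (fun z => φ z 0) (2 * π) := fun z => hper z 0
  obtain ⟨y, hy, hyz⟩ := hP.exists_mem_Ico₀ pp ξ
  have hyz' : φ ξ 0 = φ y 0 := hyz
  rw [hyz']
  exact hK ⟨y, ⟨hy.1, hy.2.le⟩, rfl⟩

structure LS (T : ℝ) (x y ρ : ℝ → ℝ → ℝ) : Prop where
  T_pos : 0 < T
  sr : Sm T ρ
  sx : Sm T x
  sy : Sm T y
  rp : ∀ ξ t : ℝ, 0 ≤ t → t < T → 0 < ρ ξ t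
  xper : ∀ ξ t : ℝ, x (ξ + 2 * π) t = x ξ t
  yper : ∀ ξ t : ℝ, y (ξ + 2 * π) t = y ξ t
  rper : ∀ ξ t : ℝ, ρ (ξ + 2 * π) t = ρ ξ t
  ex : ∀ ξ t : ℝ, 0 < t → t < T →
    pdt x ξ t = Ds ρ (Ds ρ x) ξ t + (Ds ρ x ξ t + 2 * Ds ρ y ξ t) * Ds ρ x ξ t
      - 2 * Real.exp (2 * x ξ t - 4 * y ξ t)
  ey : ∀ ξ t : ℝ, 0 < t → t < T →
    pdt y ξ t = Ds ρ (Ds ρ y) ξ t + (Ds ρ x ξ t + 2 * Ds ρ y ξ t) * Ds ρ y ξ t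
      + 2 * Real.exp (2 * x ξ t - 4 * y ξ t) - 4 * Real.exp (-2 * y ξ t)
  er : ∀ ξ t : ℝ, 0 < t → t < T →
    pdt (fun x τ => Real.log (ρ x τ)) ξ t
      = Ds ρ (Ds ρ x) ξ t + (Ds ρ x ξ t) ^ 2 + 2 * Ds ρ (Ds ρ y) ξ t + 2 * (Ds ρ y ξ t) ^ 2

namespace LS
variable {T : ℝ} {x y ρ : ℝ → ℝ → ℝ}

lemma sD (h : LS T x y ρ) {φ : ℝ → ℝ → ℝ} (hφ : Sm T φ) : Sm T (Ds ρ φ) := Sm.Ds h.sr h.rp hφ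

lemma hD (h : LS T x y ρ) {φ : ℝ → ℝ → ℝ} (hφ : Sm T φ) {t : ℝ} (h0 : 0 < t) (hT : t < T) (ξ : ℝ) :
    HasDerivAt (fun z => φ z t) (Ds ρ φ ξ t * ρ ξ t) ξ := hasDs h.rp hφ h0.le hT

/-- exponentials -/
lemma hP (h : LS T x y ρ) {t : ℝ} (h0 : 0 < t) (hT : t < T) (ξ : ℝ) :
    HasDerivAt (fun z => Real.exp (2 * x z t - 4 * y z t))
      (Real.exp (2 * x ξ t - 4 * y ξ t) * (2 * (Ds ρ x ξ t * ρ ξ t) - 4 * (Ds ρ y ξ t * ρ ξ t))) ξ :=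
  (((h.hD h.sx h0 hT ξ).const_mul 2).sub ((h.hD h.sy h0 hT ξ).const_mul 4)).exp

lemma hQ (h : LS T x y ρ) {t : ℝ} (h0 : 0 < t) (hT : t < T) (ξ : ℝ) :
    HasDerivAt (fun z => Real.exp (-2 * y z t))
      (Real.exp (-2 * y ξ t) * (-2 * (Ds ρ y ξ t * ρ ξ t))) ξ :=
  ((h.hD h.sy h0 hT ξ).const_mul (-2)).exp

lemma ep (h : LS T x y ρ) (ξ t : ℝ) (h0 : 0 < t) (hT : t < T) :
    pdt (Ds ρ x) ξ t = Ds ρ (Ds ρ (Ds ρ x)) ξ t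
      + (Ds ρ x ξ t + 2 * Ds ρ y ξ t) * Ds ρ (Ds ρ x) ξ t
      - ((Ds ρ x ξ t) ^ 2 + 2 * (Ds ρ y ξ t) ^ 2) * Ds ρ x ξ t
      - 4 * Real.exp (2 * x ξ t - 4 * y ξ t) * (Ds ρ x ξ t - 2 * Ds ρ y ξ t) := by
  have hp := h.hD (h.sD h.sx) h0 hT ξ
  have hq := h.hD (h.sD h.sy) h0 hT ξ
  have hA := h.hD (h.sD (h.sD h.sx)) h0 hT ξ
  have e := (hA.add ((hp.add (hq.const_mul 2)).mul hp)).sub ((h.hP h0 hT ξ).const_mul 2)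
  have key : Ds ρ (pdt x) ξ t = Ds ρ (Ds ρ (Ds ρ x)) ξ t
      + ((Ds ρ (Ds ρ x) ξ t + 2 * Ds ρ (Ds ρ y) ξ t) * Ds ρ x ξ t
      + (Ds ρ x ξ t + 2 * Ds ρ y ξ t) * Ds ρ (Ds ρ x) ξ t)
      - 2 * (Real.exp (2 * x ξ t - 4 * y ξ t) * (2 * Ds ρ x ξ t - 4 * Ds ρ y ξ t)) := by
    apply Ds_of (h.rp ξ t h0.le hT)
    rw [show (fun z => pdt x z t) = _ from funext (fun z => h.ex z t h0 hT)]
    refine HasDerivAt.congr_deriv e ?_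
    simp only [Pi.add_apply]
    ring
  rw [pdt_Ds h.sr h.rp h.sx h0 hT, key, h.er ξ t h0 hT]
  ring

lemma eq (h : LS T x y ρ) (ξ t : ℝ) (h0 : 0 < t) (hT : t < T) :
    pdt (Ds ρ y) ξ t = Ds ρ (Ds ρ (Ds ρ y)) ξ t
      + (Ds ρ x ξ t + 2 * Ds ρ y ξ t) * Ds ρ (Ds ρ y) ξ t
      - ((Ds ρ x ξ t) ^ 2 + 2 * (Ds ρ y ξ t) ^ 2) * Ds ρ y ξ t
      + 4 * Real.exp (2 * x ξ t - 4 * y ξ t) * (Ds ρ x ξ t - 2 * Ds ρ y ξ t)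
      + 8 * Real.exp (-2 * y ξ t) * Ds ρ y ξ t := by
  have hp := h.hD (h.sD h.sx) h0 hT ξ
  have hq := h.hD (h.sD h.sy) h0 hT ξ
  have hB := h.hD (h.sD (h.sD h.sy)) h0 hT ξ
  have e := ((hB.add ((hp.add (hq.const_mul 2)).mul hq)).add ((h.hP h0 hT ξ).const_mul 2)).sub
    ((h.hQ h0 hT ξ).const_mul 4)
  have key : Ds ρ (pdt y) ξ t = Ds ρ (Ds ρ (Ds ρ y)) ξ t
      + ((Ds ρ (Ds ρ x) ξ t + 2 * Ds ρ (Ds ρ y) ξ t) * Ds ρ y ξ t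
      + (Ds ρ x ξ t + 2 * Ds ρ y ξ t) * Ds ρ (Ds ρ y) ξ t)
      + 2 * (Real.exp (2 * x ξ t - 4 * y ξ t) * (2 * Ds ρ x ξ t - 4 * Ds ρ y ξ t))
      - 4 * (Real.exp (-2 * y ξ t) * (-2 * Ds ρ y ξ t)) := by
    apply Ds_of (h.rp ξ t h0.le hT)
    rw [show (fun z => pdt y z t) = _ from funext (fun z => h.ey z t h0 hT)]
    refine HasDerivAt.congr_deriv e ?_
    simp only [Pi.add_apply]
    ring
  rw [pdt_Ds h.sr h.rp h.sy h0 hT, key, h.er ξ t h0 hT]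
  ring

lemma eA (h : LS T x y ρ) (ξ t : ℝ) (h0 : 0 < t) (hT : t < T) :
    pdt (Ds ρ (Ds ρ x)) ξ t = Ds ρ (Ds ρ (Ds ρ (Ds ρ x))) ξ t
      + (Ds ρ x ξ t + 2 * Ds ρ y ξ t) * Ds ρ (Ds ρ (Ds ρ x)) ξ t
      - (4 * (Ds ρ x ξ t) ^ 2 + 4 * (Ds ρ y ξ t) ^ 2) * Ds ρ (Ds ρ x) ξ t
      - 4 * Ds ρ x ξ t * Ds ρ y ξ t * Ds ρ (Ds ρ y) ξ t
      - 4 * Real.exp (2 * x ξ t - 4 * y ξ t) * (Ds ρ (Ds ρ x) ξ t - 2 * Ds ρ (Ds ρ y) ξ t)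
      - 8 * Real.exp (2 * x ξ t - 4 * y ξ t) * (Ds ρ x ξ t - 2 * Ds ρ y ξ t) ^ 2 := by
  have hp := h.hD (h.sD h.sx) h0 hT ξ
  have hq := h.hD (h.sD h.sy) h0 hT ξ
  have hA := h.hD (h.sD (h.sD h.sx)) h0 hT ξ
  have h3 := h.hD (h.sD (h.sD (h.sD h.sx))) h0 hT ξ
  have e := ((h3.add ((hp.add (hq.const_mul 2)).mul hA)).sub
    (((hp.pow 2).add ((hq.pow 2).const_mul 2)).mul hp)).sub
    (((h.hP h0 hT ξ).const_mul 4).mul (hp.sub (hq.const_mul 2)))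
  have key : Ds ρ (pdt (Ds ρ x)) ξ t = Ds ρ (Ds ρ (Ds ρ (Ds ρ x))) ξ t
      + ((Ds ρ (Ds ρ x) ξ t + 2 * Ds ρ (Ds ρ y) ξ t) * Ds ρ (Ds ρ x) ξ t
      + (Ds ρ x ξ t + 2 * Ds ρ y ξ t) * Ds ρ (Ds ρ (Ds ρ x)) ξ t)
      - ((2 * Ds ρ x ξ t * Ds ρ (Ds ρ x) ξ t + 4 * Ds ρ y ξ t * Ds ρ (Ds ρ y) ξ t) * Ds ρ x ξ t
        + ((Ds ρ x ξ t) ^ 2 + 2 * (Ds ρ y ξ t) ^ 2) * Ds ρ (Ds ρ x) ξ t)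
      - 4 * Real.exp (2 * x ξ t - 4 * y ξ t) * (Ds ρ (Ds ρ x) ξ t - 2 * Ds ρ (Ds ρ y) ξ t)
      - 8 * Real.exp (2 * x ξ t - 4 * y ξ t) * (Ds ρ x ξ t - 2 * Ds ρ y ξ t) ^ 2 := by
    apply Ds_of (h.rp ξ t h0.le hT)
    rw [show (fun z => pdt (Ds ρ x) z t) = _ from funext (fun z => h.ep z t h0 hT)]
    refine HasDerivAt.congr_deriv e ?_
    simp only [Pi.add_apply, Pi.sub_apply, Pi.mul_apply, Pi.pow_apply]
    push_cast
    ring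
  rw [pdt_Ds h.sr h.rp (h.sD h.sx) h0 hT, key, h.er ξ t h0 hT]
  ring

lemma eB (h : LS T x y ρ) (ξ t : ℝ) (h0 : 0 < t) (hT : t < T) :
    pdt (Ds ρ (Ds ρ y)) ξ t = Ds ρ (Ds ρ (Ds ρ (Ds ρ y))) ξ t
      + (Ds ρ x ξ t + 2 * Ds ρ y ξ t) * Ds ρ (Ds ρ (Ds ρ y)) ξ t
      - 2 * ((Ds ρ x ξ t) ^ 2 + 2 * (Ds ρ y ξ t) ^ 2) * Ds ρ (Ds ρ y) ξ t
      - (2 * Ds ρ x ξ t * Ds ρ (Ds ρ x) ξ t + 4 * Ds ρ y ξ t * Ds ρ (Ds ρ y) ξ t) * Ds ρ y ξ t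
      + 4 * Real.exp (2 * x ξ t - 4 * y ξ t) * (Ds ρ (Ds ρ x) ξ t - 2 * Ds ρ (Ds ρ y) ξ t)
      + 8 * Real.exp (2 * x ξ t - 4 * y ξ t) * (Ds ρ x ξ t - 2 * Ds ρ y ξ t) ^ 2
      + 8 * Real.exp (-2 * y ξ t) * Ds ρ (Ds ρ y) ξ t
      - 16 * Real.exp (-2 * y ξ t) * (Ds ρ y ξ t) ^ 2 := by
  have hp := h.hD (h.sD h.sx) h0 hT ξ
  have hq := h.hD (h.sD h.sy) h0 hT ξ
  have hB := h.hD (h.sD (h.sD h.sy)) h0 hT ξ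
  have h3 := h.hD (h.sD (h.sD (h.sD h.sy))) h0 hT ξ
  have e := ((((h3.add ((hp.add (hq.const_mul 2)).mul hB)).sub
    (((hp.pow 2).add ((hq.pow 2).const_mul 2)).mul hq)).add
    (((h.hP h0 hT ξ).const_mul 4).mul (hp.sub (hq.const_mul 2))))).add
    (((h.hQ h0 hT ξ).const_mul 8).mul hq)
  have key : Ds ρ (pdt (Ds ρ y)) ξ t = Ds ρ (Ds ρ (Ds ρ (Ds ρ y))) ξ t
      + ((Ds ρ (Ds ρ x) ξ t + 2 * Ds ρ (Ds ρ y) ξ t) * Ds ρ (Ds ρ y) ξ t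
      + (Ds ρ x ξ t + 2 * Ds ρ y ξ t) * Ds ρ (Ds ρ (Ds ρ y)) ξ t)
      - ((2 * Ds ρ x ξ t * Ds ρ (Ds ρ x) ξ t + 4 * Ds ρ y ξ t * Ds ρ (Ds ρ y) ξ t) * Ds ρ y ξ t
        + ((Ds ρ x ξ t) ^ 2 + 2 * (Ds ρ y ξ t) ^ 2) * Ds ρ (Ds ρ y) ξ t)
      + 4 * Real.exp (2 * x ξ t - 4 * y ξ t) * (Ds ρ (Ds ρ x) ξ t - 2 * Ds ρ (Ds ρ y) ξ t)
      + 8 * Real.exp (2 * x ξ t - 4 * y ξ t) * (Ds ρ x ξ t - 2 * Ds ρ y ξ t) ^ 2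
      + 8 * Real.exp (-2 * y ξ t) * Ds ρ (Ds ρ y) ξ t
      - 16 * Real.exp (-2 * y ξ t) * (Ds ρ y ξ t) ^ 2 := by
    apply Ds_of (h.rp ξ t h0.le hT)
    rw [show (fun z => pdt (Ds ρ y) z t) = _ from funext (fun z => h.eq z t h0 hT)]
    refine HasDerivAt.congr_deriv e ?_
    simp only [Pi.add_apply, Pi.sub_apply, Pi.mul_apply, Pi.pow_apply]
    push_cast
    ring
  rw [pdt_Ds h.sr h.rp (h.sD h.sy) h0 hT, key, h.er ξ t h0 hT]
  ring

/-- `f ≤ g` is preserved -/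
lemma order (h : LS T x y ρ) (hi : ∀ ξ, x ξ 0 ≤ y ξ 0) (ξ t : ℝ) (h0 : 0 ≤ t) (hT : t < T) :
    x ξ t ≤ y ξ t := by
  have hs : Sm T (fun ξ t => x ξ t - y ξ t) := ContDiffOn.sub h.sx h.sy
  have := max_principle h.sr h.rp hs (fun ξ t => by rw [h.xper, h.yper]) 0
    (fun ξ => by linarith [hi ξ]) ?_ ξ t h0 hT
  · linarith
  intro ξ t h0 hT hpos hd1 hd2
  have e1 : ∀ z, Ds ρ (fun ξ t => x ξ t - y ξ t) z t = Ds ρ x z t - Ds ρ y z t := by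
    intro z
    apply Ds_of (h.rp z t h0.le hT)
    refine HasDerivAt.congr_deriv ((h.hD h.sx h0 hT z).sub (h.hD h.sy h0 hT z)) (by ring)
  have e2 : Ds ρ (Ds ρ (fun ξ t => x ξ t - y ξ t)) ξ t
      = Ds ρ (Ds ρ x) ξ t - Ds ρ (Ds ρ y) ξ t := by
    apply Ds_of (h.rp ξ t h0.le hT)
    rw [show (fun z => Ds ρ (fun ξ t => x ξ t - y ξ t) z t) = _ from funext e1]
    refine HasDerivAt.congr_deriv
      ((h.hD (h.sD h.sx) h0 hT ξ).sub (h.hD (h.sD h.sy) h0 hT ξ)) (by ring)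
  have e3 : pdt (fun ξ t => x ξ t - y ξ t) ξ t = pdt x ξ t - pdt y ξ t :=
    ((h.sx.hasDt (ξ := ξ) h0 hT).sub (h.sy.hasDt (ξ := ξ) h0 hT)).deriv
  rw [e1] at hd1
  rw [e2] at hd2
  rw [e3, h.ex ξ t h0 hT, h.ey ξ t h0 hT]
  have hexp : Real.exp (-2 * y ξ t) ≤ Real.exp (2 * x ξ t - 4 * y ξ t) :=
    Real.exp_le_exp.mpr (by linarith)
  have hpq : Ds ρ x ξ t = Ds ρ y ξ t := by linarith
  rw [hpq]
  linarith

def Phi (α β : ℝ) (x y ρ : ℝ → ℝ → ℝ) : ℝ → ℝ → ℝ := fun ξ t =>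
  Real.exp (2 * y ξ t) * (α * Ds ρ (Ds ρ x) ξ t + β * Ds ρ (Ds ρ y) ξ t
    + (Ds ρ x ξ t) ^ 2 + 2 * (Ds ρ y ξ t) ^ 2)

lemma sPhi (h : LS T x y ρ) (α β : ℝ) : Sm T (Phi α β x y ρ) := by
  have h1 : ContDiffOn ℝ _ _ _ := h.sy
  have h2 : ContDiffOn ℝ _ _ _ := h.sD h.sx
  have h3 : ContDiffOn ℝ _ _ _ := h.sD h.sy
  have h4 : ContDiffOn ℝ _ _ _ := h.sD (h.sD h.sx)
  have h5 : ContDiffOn ℝ _ _ _ := h.sD (h.sD h.sy)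
  exact (contDiffOn_const.mul h1).exp.mul ((((contDiffOn_const.mul h4).add
    (contDiffOn_const.mul h5)).add (h2.pow 2)).add (contDiffOn_const.mul (h3.pow 2)))

lemma perPhi (h : LS T x y ρ) (α β : ℝ) (ξ t : ℝ) :
    Phi α β x y ρ (ξ + 2 * π) t = Phi α β x y ρ ξ t := by
  have hp := Ds_per h.rper h.xper
  have hq := Ds_per h.rper h.yper
  have hA := Ds_per h.rper hp
  have hB := Ds_per h.rper hq
  unfold Phi
  rw [h.yper, hp, hq, hA, hB]

lemma evPhi (h : LS T x y ρ) (α β : ℝ) (ξ t : ℝ) (h0 : 0 < t) (hT : t < T)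
    (hd1 : Ds ρ (Phi α β x y ρ) ξ t = 0) (hd2 : Ds ρ (Ds ρ (Phi α β x y ρ)) ξ t ≤ 0) :
    ∀ p q A B P Q V p3 q3 : ℝ, p = Ds ρ x ξ t → q = Ds ρ y ξ t → A = Ds ρ (Ds ρ x) ξ t →
      B = Ds ρ (Ds ρ y) ξ t → P = Real.exp (2 * x ξ t - 4 * y ξ t) →
      Q = Real.exp (-2 * y ξ t) → V = α * A + β * B + p ^ 2 + 2 * q ^ 2 →
      p3 = Ds ρ (Ds ρ (Ds ρ x)) ξ t → q3 = Ds ρ (Ds ρ (Ds ρ y)) ξ t →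
    (α * p3 + β * q3 + 2 * p * A + 4 * q * B = -2 * q * V) ∧
    pdt (Phi α β x y ρ) ξ t ≤ Real.exp (2 * y ξ t) * ((4 * q ^ 2 + 4 * P - 8 * Q) * V
      + α * (- (4 * p ^ 2 + 4 * q ^ 2) * A - 4 * p * q * B - 4 * P * (A - 2 * B)
        - 8 * P * (p - 2 * q) ^ 2)
      + β * (- 2 * (p ^ 2 + 2 * q ^ 2) * B - (2 * p * A + 4 * q * B) * q + 4 * P * (A - 2 * B)
        + 8 * P * (p - 2 * q) ^ 2 + 8 * Q * B - 16 * Q * q ^ 2)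
      - 2 * (A ^ 2 + 2 * B ^ 2) - 2 * (p ^ 2 + 2 * q ^ 2) ^ 2 - 8 * P * (p - 2 * q) ^ 2
      + 32 * Q * q ^ 2) := by
  intro p q A B P Q V p3 q3 ep_ eq_ eA_ eB_ eP_ eQ_ eV_ e3 e3'
  have sp := h.sD h.sx
  have sq := h.sD h.sy
  have sA := h.sD sp
  have sB := h.sD sq
  have s3 := h.sD sA
  have s3' := h.sD sB
  have e1 : ∀ z, Ds ρ (Phi α β x y ρ) z t = Real.exp (2 * y z t) *
      (2 * Ds ρ y z t * (α * Ds ρ (Ds ρ x) z t + β * Ds ρ (Ds ρ y) z t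
    + (Ds ρ x z t) ^ 2 + 2 * (Ds ρ y z t) ^ 2) + (α * Ds ρ (Ds ρ (Ds ρ x)) z t
    + β * Ds ρ (Ds ρ (Ds ρ y)) z t + 2 * Ds ρ x z t * Ds ρ (Ds ρ x) z t
    + 4 * Ds ρ y z t * Ds ρ (Ds ρ y) z t)) := by
    intro z
    apply Ds_of (h.rp z t h0.le hT)
    refine HasDerivAt.congr_deriv ((((h.hD h.sy h0 hT z).const_mul 2).exp).mul
      (((((h.hD sA h0 hT z).const_mul α).add ((h.hD sB h0 hT z).const_mul β)).add
        ((h.hD sp h0 hT z).pow 2)).add (((h.hD sq h0 hT z).pow 2).const_mul 2))) ?_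
    try simp only [Pi.add_apply, Pi.sub_apply, Pi.mul_apply, Pi.pow_apply]
    push_cast
    ring
  have e2 : Ds ρ (Ds ρ (Phi α β x y ρ)) ξ t = Real.exp (2 * y ξ t) *
      (2 * q * (2 * q * V + (α * p3 + β * q3 + 2 * p * A + 4 * q * B))
       + 2 * B * V + 2 * q * (α * p3 + β * q3 + 2 * p * A + 4 * q * B)
       + (α * Ds ρ (Ds ρ (Ds ρ (Ds ρ x))) ξ t + β * Ds ρ (Ds ρ (Ds ρ (Ds ρ y))) ξ t
         + 2 * A ^ 2 + 2 * p * p3 + 4 * B ^ 2 + 4 * q * q3)) := by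
    apply Ds_of (h.rp ξ t h0.le hT)
    rw [show (fun z => Ds ρ (Phi α β x y ρ) z t) = _ from funext e1]
    have hy := h.hD h.sy h0 hT ξ
    have hp := h.hD sp h0 hT ξ
    have hq := h.hD sq h0 hT ξ
    have hA := h.hD sA h0 hT ξ
    have hB := h.hD sB h0 hT ξ
    have h3 := h.hD s3 h0 hT ξ
    have h3' := h.hD s3' h0 hT ξ
    refine HasDerivAt.congr_deriv (((hy.const_mul 2).exp).mul
      (((hq.const_mul 2).mul (((((hA).const_mul α).add ((hB).const_mul β)).add
        ((hp).pow 2)).add (((hq).pow 2).const_mul 2))).add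
        ((((h3.const_mul α).add (h3'.const_mul β)).add ((hp.const_mul 2).mul hA)).add
          ((hq.const_mul 4).mul hB)))) ?_
    simp only [Pi.add_apply, Pi.sub_apply, Pi.mul_apply, Pi.pow_apply]
    push_cast
    rw [eV_, e3, e3', ep_, eq_, eA_, eB_]
    ring
  have et : pdt (Phi α β x y ρ) ξ t = Real.exp (2 * y ξ t) *
      (2 * pdt y ξ t * V + α * pdt (Ds ρ (Ds ρ x)) ξ t + β * pdt (Ds ρ (Ds ρ y)) ξ t
        + 2 * p * pdt (Ds ρ x) ξ t + 4 * q * pdt (Ds ρ y) ξ t) := by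
    have hy := h.sy.hasDt (ξ := ξ) h0 hT
    have hp := sp.hasDt (ξ := ξ) h0 hT
    have hq := sq.hasDt (ξ := ξ) h0 hT
    have hA := sA.hasDt (ξ := ξ) h0 hT
    have hB := sB.hasDt (ξ := ξ) h0 hT
    have e := ((hy.const_mul 2).exp).mul
      (((((hA).const_mul α).add ((hB).const_mul β)).add
        ((hp).pow 2)).add (((hq).pow 2).const_mul 2))
    have e' : pdt (Phi α β x y ρ) ξ t = _ := e.deriv
    rw [e']
    simp only [Pi.add_apply, Pi.sub_apply, Pi.mul_apply, Pi.pow_apply]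
    push_cast
    rw [eV_, ep_, eq_, eA_, eB_]
    ring
  have hG := Real.exp_pos (2 * y ξ t)
  rw [e1, ← e3, ← e3', ← ep_, ← eq_, ← eA_, ← eB_, ← eV_] at hd1
  have c1 : α * p3 + β * q3 + 2 * p * A + 4 * q * B = -2 * q * V := by
    have := (mul_eq_zero.mp hd1).resolve_left hG.ne'
    linarith
  refine ⟨c1, ?_⟩
  rw [e2] at hd2
  have c2 := nonpos_of_mul_nonpos_right hd2 hG
  rw [et, h.ey ξ t h0 hT, h.eA ξ t h0 hT, h.eB ξ t h0 hT, h.ep ξ t h0 hT, h.eq ξ t h0 hT,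
    ← e3, ← e3', ← ep_, ← eq_, ← eA_, ← eB_, ← eP_, ← eQ_]
  apply mul_le_mul_of_nonneg_left _ hG.le
  rw [c1] at c2
  have c3 : (p + 2 * q) * (α * p3 + β * q3 + 2 * p * A + 4 * q * B)
    = (p + 2 * q) * (-2 * q * V) := by rw [c1]
  nlinarith [c2, c3]

end LS
lemma alg1 (p q A B P Q V K : ℝ) (hP : 0 ≤ P) (hPQ : P ≤ Q) (hK : 12 ≤ K)
    (hV : V = p ^ 2 + 2 * q ^ 2) (hc : 2 * p * A + 4 * q * B = -2 * q * V) (hVK : K * Q < V) :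
    (4 * q ^ 2 + 4 * P - 8 * Q) * V - 2 * (A ^ 2 + 2 * B ^ 2) - 2 * (p ^ 2 + 2 * q ^ 2) ^ 2
      - 8 * P * (p - 2 * q) ^ 2 + 32 * Q * q ^ 2 ≤ 0 := by
  have hQ : 0 ≤ Q := hP.trans hPQ
  have hV0 : 0 < V := lt_of_le_of_lt (by positivity) hVK
  have h1 : q ^ 2 * V ≤ A ^ 2 + 2 * B ^ 2 := by
    have h2 : (p * A + 2 * q * B) ^ 2 = q ^ 2 * V ^ 2 := by
      rw [show p * A + 2 * q * B = - (q * V) by linarith]; ring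
    have h3 : V * (q ^ 2 * V) ≤ V * (A ^ 2 + 2 * B ^ 2) := by
      have : V * (A ^ 2 + 2 * B ^ 2) = (p * A + 2 * q * B) ^ 2 + 2 * (p * B - q * A) ^ 2 := by
        rw [hV]; ring
      nlinarith [sq_nonneg (p * B - q * A)]
    exact le_of_mul_le_mul_left h3 hV0
  have h4 : 0 ≤ P * (p - 2 * q) ^ 2 := by positivity
  have h5 : P * V ≤ Q * V := mul_le_mul_of_nonneg_right hPQ hV0.le
  have h6 : 2 * q ^ 2 ≤ V := by rw [hV]; nlinarith [sq_nonneg p]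
  have h7 : 2 * q ^ 2 * V ≤ V * V := mul_le_mul_of_nonneg_right h6 hV0.le
  have h8 : Q * (2 * q ^ 2) ≤ Q * V := mul_le_mul_of_nonneg_left h6 hQ
  have h9 : 12 * Q * V ≤ V * V := by
    apply mul_le_mul_of_nonneg_right _ hV0.le
    nlinarith
  rw [← hV]
  nlinarith

set_option maxHeartbeats 1000000 in
lemma alg2 (α β p q A B P Q V K : ℝ) (hα : |α| ≤ 1) (hβ : |β| ≤ 1)
    (hP : 0 ≤ P) (hPQ : P ≤ Q) (hQ : 0 < Q) (hK : 12 ≤ K)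
    (hE : p ^ 2 + 2 * q ^ 2 ≤ K * Q)
    (hV : V = α * A + β * B + p ^ 2 + 2 * q ^ 2)
    (hVK : (K + 1 + 2 * (82 * K + 24 + 2 * K ^ 2)) * Q < V) :
    (4 * q ^ 2 + 4 * P - 8 * Q) * V
      + α * (- (4 * p ^ 2 + 4 * q ^ 2) * A - 4 * p * q * B - 4 * P * (A - 2 * B)
        - 8 * P * (p - 2 * q) ^ 2)
      + β * (- 2 * (p ^ 2 + 2 * q ^ 2) * B - (2 * p * A + 4 * q * B) * q + 4 * P * (A - 2 * B)
        + 8 * P * (p - 2 * q) ^ 2 + 8 * Q * B - 16 * Q * q ^ 2)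
      - 2 * (A ^ 2 + 2 * B ^ 2) - 2 * (p ^ 2 + 2 * q ^ 2) ^ 2 - 8 * P * (p - 2 * q) ^ 2
      + 32 * Q * q ^ 2 ≤ 0 := by
  have key : ∀ γ X : ℝ, |γ| ≤ 1 → γ * X ≤ |X| := by
    intro γ X hγ
    calc γ * X ≤ |γ * X| := le_abs_self _
      _ = |γ| * |X| := abs_mul _ _
      _ ≤ 1 * |X| := mul_le_mul_of_nonneg_right hγ (abs_nonneg _)
      _ = |X| := one_mul _
  set E := p ^ 2 + 2 * q ^ 2 with hEd
  have hE0 : 0 ≤ E := by positivity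
  set m := |A| + |B| with hm
  have hA0 := abs_nonneg A
  have hB0 := abs_nonneg B
  have hm0 : 0 ≤ m := by positivity
  have hAm : |A| ≤ m := by linarith
  have hBm : |B| ≤ m := by linarith
  have hVm : V ≤ m + K * Q := by
    have := key α A hα
    have := key β B hβ
    rw [hV]; linarith
  have hKQ : 0 ≤ K * Q := by nlinarith
  have hV0 : 0 < V := lt_of_le_of_lt (by positivity) hVK
  have hmQ : (1 + 2 * (82 * K + 24 + 2 * K ^ 2)) * Q ≤ m := by nlinarith
  have hpq : |p * q| ≤ E / 2 := by
    rw [abs_le]; constructor <;> nlinarith [sq_nonneg (p - q), sq_nonneg (p + q), sq_nonneg q]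
  have hpq3 : (p - 2 * q) ^ 2 ≤ 3 * E := by nlinarith [sq_nonneg (p + q)]
  have hq2 : q ^ 2 ≤ E / 2 := by nlinarith [sq_nonneg p]
  have hPpq : P * (p - 2 * q) ^ 2 ≤ 3 * Q * (K * Q) := by
    calc P * (p - 2 * q) ^ 2 ≤ Q * (3 * E) := mul_le_mul hPQ hpq3 (sq_nonneg _) hQ.le
      _ ≤ Q * (3 * (K * Q)) := mul_le_mul_of_nonneg_left (by linarith) hQ.le
      _ = _ := by ring
  have hPpq0 : 0 ≤ P * (p - 2 * q) ^ 2 := by positivity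
  -- elementary absolute value bounds
  have bnd : ∀ c C X Y : ℝ, |c| ≤ C → |X| ≤ Y → |c * X| ≤ C * Y := by
    intro c C X Y h1 h2
    rw [abs_mul]
    exact mul_le_mul h1 h2 (abs_nonneg _) ((abs_nonneg _).trans h1)
  have hEm : E * m ≤ K * Q * m := mul_le_mul_of_nonneg_right hE hm0
  have t1 : |(4 * p ^ 2 + 4 * q ^ 2) * A| ≤ 4 * (K * Q) * |A| :=
    bnd _ _ _ _ (by rw [abs_of_nonneg (by positivity)]; nlinarith [sq_nonneg q]) le_rfl
  have t2 : |(p * q) * B| ≤ (K * Q) / 2 * |B| := bnd _ _ _ _ (by linarith) le_rfl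
  have t2' : |(p * q) * A| ≤ (K * Q) / 2 * |A| := bnd _ _ _ _ (by linarith) le_rfl
  have t3 : |P * A| ≤ Q * |A| := bnd _ _ _ _ (by rwa [abs_of_nonneg hP]) le_rfl
  have t4 : |P * B| ≤ Q * |B| := bnd _ _ _ _ (by rwa [abs_of_nonneg hP]) le_rfl
  have t5 : |E * B| ≤ (K * Q) * |B| := bnd _ _ _ _ (by rwa [abs_of_nonneg hE0]) le_rfl
  have t6 : |q ^ 2 * B| ≤ (K * Q) / 2 * |B| :=
    bnd _ _ _ _ (by rw [abs_of_nonneg (sq_nonneg q)]; linarith) le_rfl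
  have t7 : |Q * B| ≤ Q * |B| := bnd _ _ _ _ (by rw [abs_of_pos hQ]) le_rfl
  have t8 : Q * q ^ 2 ≤ Q * (K * Q) / 2 := by
    have := mul_le_mul_of_nonneg_left (hq2.trans (by linarith : E / 2 ≤ K * Q / 2)) hQ.le
    linarith
  have t80 : 0 ≤ Q * q ^ 2 := by positivity
  have kqa : 0 ≤ K * Q * |A| := by positivity
  have kqb : 0 ≤ K * Q * |B| := by positivity
  have qa : 0 ≤ Q * |A| := by positivity
  have qb : 0 ≤ Q * |B| := by positivity
  rw [abs_le] at t1 t2 t2' t3 t4 t5 t6 t7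
  have hRA : |- (4 * p ^ 2 + 4 * q ^ 2) * A - 4 * p * q * B - 4 * P * (A - 2 * B)
        - 8 * P * (p - 2 * q) ^ 2| ≤ (4 * K + 8) * Q * m + 24 * K * Q ^ 2 := by
    rw [hm, abs_le]; constructor <;> linarith
  have hRB : |- 2 * E * B - (2 * p * A + 4 * q * B) * q + 4 * P * (A - 2 * B)
        + 8 * P * (p - 2 * q) ^ 2 + 8 * Q * B - 16 * Q * q ^ 2|
        ≤ (4 * K + 16) * Q * m + 32 * K * Q ^ 2 := by
    rw [hm, abs_le]; constructor <;> linarith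
  have hRA' := (key α _ hα).trans hRA
  have hRB' := (key β _ hβ).trans hRB
  have h1 : (4 * q ^ 2 + 4 * P - 8 * Q) * V ≤ 2 * (K * Q) * (m + K * Q) := by
    calc _ ≤ 2 * (K * Q) * V := mul_le_mul_of_nonneg_right (by linarith) hV0.le
      _ ≤ _ := mul_le_mul_of_nonneg_left hVm (by positivity)
  have h2 : m ^ 2 ≤ 2 * (A ^ 2 + 2 * B ^ 2) := by
    rw [hm]; linarith [sq_abs A, sq_abs B, sq_nonneg (|A| - |B|), sq_nonneg B]
  have h3 : (1 + 2 * (82 * K + 24 + 2 * K ^ 2)) * Q * m ≤ m ^ 2 := by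
    rw [sq m]; exact mul_le_mul_of_nonneg_right hmQ hm0
  have hQm : Q ≤ m := by
    have : 0 ≤ 2 * (82 * K + 24 + 2 * K ^ 2) * Q := by positivity
    linarith
  have hQQ : Q ^ 2 ≤ Q * m := by rw [sq]; exact mul_le_mul_of_nonneg_left hQm hQ.le
  have hQQ' : (82 * K + 24 + 2 * K ^ 2) * Q ^ 2 ≤ (82 * K + 24 + 2 * K ^ 2) * (Q * m) :=
    mul_le_mul_of_nonneg_left hQQ (by positivity)
  have hfin : (10 * K + 24) * (Q * m) + (74 * K + 2 * K ^ 2) * Q ^ 2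
      ≤ (1 + 2 * (82 * K + 24 + 2 * K ^ 2)) * (Q * m) := by
    have : 0 ≤ Q * m := by positivity
    have : 0 ≤ K * (Q * m) := by positivity
    have : 0 ≤ K ^ 2 * (Q * m) := by positivity
    have : 0 ≤ K * Q ^ 2 := by positivity
    have : 0 ≤ Q ^ 2 := by positivity
    linarith
  have hE2 : 0 ≤ E ^ 2 := sq_nonneg _
  linarith

namespace LS
variable {T : ℝ} {x y ρ : ℝ → ℝ → ℝ}

lemma PQ (h : LS T x y ρ) (hi : ∀ ξ, x ξ 0 ≤ y ξ 0) {ξ t : ℝ} (h0 : 0 ≤ t) (hT : t < T) :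
    Real.exp (2 * x ξ t - 4 * y ξ t) ≤ Real.exp (-2 * y ξ t) :=
  Real.exp_le_exp.mpr (by linarith [h.order hi ξ t h0 hT])

lemma GQ (y : ℝ) : Real.exp (2 * y) * Real.exp (-2 * y) = 1 := by
  rw [← Real.exp_add]; simp

lemma lt_of_GV {y K V : ℝ} (h : K < Real.exp (2 * y) * V) : K * Real.exp (-2 * y) < V := by
  have hq := Real.exp_pos (-2 * y)
  have := mul_lt_mul_of_pos_right h hq
  have e := GQ y
  calc _ < _ := this
    _ = (Real.exp (2 * y) * Real.exp (-2 * y)) * V := by ring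
    _ = V := by rw [e, one_mul]

lemma le_of_GV {y K V : ℝ} (h : Real.exp (2 * y) * V ≤ K) : V ≤ K * Real.exp (-2 * y) := by
  have hq := Real.exp_pos (-2 * y)
  have := mul_le_mul_of_nonneg_right h hq.le
  have e := GQ y
  calc V = (Real.exp (2 * y) * Real.exp (-2 * y)) * V := by rw [e, one_mul]
    _ = _ := by ring
    _ ≤ _ := this

lemma grad (h : LS T x y ρ) (hi : ∀ ξ, x ξ 0 ≤ y ξ 0) :
    ∃ K, 12 ≤ K ∧ ∀ ξ t, 0 ≤ t → t < T →
      (Ds ρ x ξ t) ^ 2 + 2 * (Ds ρ y ξ t) ^ 2 ≤ K * Real.exp (-2 * y ξ t) := by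
  obtain ⟨K0, hK0⟩ := bdd_init h.T_pos (h.sPhi 0 0) (h.perPhi 0 0)
  refine ⟨max 12 K0, le_max_left _ _, fun ξ t h0 hT => ?_⟩
  have := max_principle h.sr h.rp (h.sPhi 0 0) (h.perPhi 0 0) (max 12 K0)
    (fun ξ => (hK0 ξ).trans (le_max_right _ _)) ?_ ξ t h0 hT
  · apply le_of_GV
    unfold Phi at this
    simpa using this
  intro ξ t h0 hT hpos hd1 hd2
  obtain ⟨c1, c2⟩ := h.evPhi 0 0 ξ t h0 hT hd1 hd2 _ _ _ _ _ _ _ _ _ rfl rfl rfl rfl rfl rfl rfl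
    rfl rfl
  refine c2.trans ?_
  refine mul_nonpos_of_nonneg_of_nonpos (Real.exp_pos _).le ?_
  have hV := lt_of_GV hpos
  simp only [zero_mul, zero_add, add_zero] at c1 hV ⊢
  exact alg1 _ _ _ _ _ _ _ _ (Real.exp_pos _).le (h.PQ hi h0.le hT) (le_max_left _ _) rfl c1 hV

lemma curv (h : LS T x y ρ) (hi : ∀ ξ, x ξ 0 ≤ y ξ 0) (α β : ℝ) (hα : |α| ≤ 1) (hβ : |β| ≤ 1) :
    ∃ K, ∀ ξ t, 0 ≤ t → t < T →
      α * Ds ρ (Ds ρ x) ξ t + β * Ds ρ (Ds ρ y) ξ t ≤ K * Real.exp (-2 * y ξ t) := by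
  obtain ⟨K, hK, hg⟩ := h.grad hi
  obtain ⟨K0, hK0⟩ := bdd_init h.T_pos (h.sPhi α β) (h.perPhi α β)
  refine ⟨max (K + 1 + 2 * (82 * K + 24 + 2 * K ^ 2)) K0, fun ξ t h0 hT => ?_⟩
  have := max_principle h.sr h.rp (h.sPhi α β) (h.perPhi α β)
    (max (K + 1 + 2 * (82 * K + 24 + 2 * K ^ 2)) K0)
    (fun ξ => (hK0 ξ).trans (le_max_right _ _)) ?_ ξ t h0 hT
  · have := le_of_GV this
    nlinarith [sq_nonneg (Ds ρ x ξ t), sq_nonneg (Ds ρ y ξ t)]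
  intro ξ t h0 hT hpos hd1 hd2
  obtain ⟨c1, c2⟩ := h.evPhi α β ξ t h0 hT hd1 hd2 _ _ _ _ _ _ _ _ _ rfl rfl rfl rfl rfl rfl rfl
    rfl rfl
  refine c2.trans ?_
  refine mul_nonpos_of_nonneg_of_nonpos (Real.exp_pos _).le ?_
  have hV := lt_of_GV (lt_of_le_of_lt (le_max_left _ _) hpos)
  exact alg2 α β _ _ _ _ _ _ _ K hα hβ (Real.exp_pos _).le (h.PQ hi h0.le hT) (Real.exp_pos _)
    hK (hg ξ t h0.le hT) rfl hV

lemma curv' (h : LS T x y ρ) (hi : ∀ ξ, x ξ 0 ≤ y ξ 0) :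
    ∃ K, 0 ≤ K ∧ ∀ ξ t, 0 ≤ t → t < T →
      |Ds ρ (Ds ρ x) ξ t| ≤ K * Real.exp (-2 * y ξ t) ∧
      |Ds ρ (Ds ρ y) ξ t| ≤ K * Real.exp (-2 * y ξ t) ∧
      (Ds ρ x ξ t) ^ 2 ≤ K * Real.exp (-2 * y ξ t) ∧
      (Ds ρ y ξ t) ^ 2 ≤ K * Real.exp (-2 * y ξ t) := by
  obtain ⟨K, hK, hg⟩ := h.grad hi
  obtain ⟨K1, h1⟩ := h.curv hi 1 0 (by simp) (by simp)
  obtain ⟨K2, h2⟩ := h.curv hi (-1) 0 (by simp) (by simp)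
  obtain ⟨K3, h3⟩ := h.curv hi 0 1 (by simp) (by simp)
  obtain ⟨K4, h4⟩ := h.curv hi 0 (-1) (by simp) (by simp)
  have hm : ∀ z ξ t, z ≤ K + |K1| + |K2| + |K3| + |K4| →
      z * Real.exp (-2 * y ξ t) ≤ (K + |K1| + |K2| + |K3| + |K4|) * Real.exp (-2 * y ξ t) :=
    fun z ξ t hz => mul_le_mul_of_nonneg_right hz (Real.exp_pos _).le
  have a1 := abs_nonneg K1
  have a2 := abs_nonneg K2
  have a3 := abs_nonneg K3
  have a4 := abs_nonneg K4
  have b1 := le_abs_self K1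
  have b2 := le_abs_self K2
  have b3 := le_abs_self K3
  have b4 := le_abs_self K4
  refine ⟨K + |K1| + |K2| + |K3| + |K4|, by linarith, fun ξ t h0 hT => ?_⟩
  have c1 := hm K1 ξ t (by linarith)
  have c2 := hm K2 ξ t (by linarith)
  have c3 := hm K3 ξ t (by linarith)
  have c4 := hm K4 ξ t (by linarith)
  have c5 := hm K ξ t (by linarith)
  have d1 := h1 ξ t h0 hT
  have d2 := h2 ξ t h0 hT
  have d3 := h3 ξ t h0 hT
  have d4 := h4 ξ t h0 hT
  have d5 := hg ξ t h0 hT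
  refine ⟨abs_le.mpr ⟨by linarith, by linarith⟩, abs_le.mpr ⟨by linarith, by linarith⟩, ?_, ?_⟩
  · nlinarith [sq_nonneg (Ds ρ y ξ t)]
  · nlinarith [sq_nonneg (Ds ρ x ξ t), sq_nonneg (Ds ρ y ξ t)]

end LS
lemma WarpedBerger.toLS {T : ℝ} {f g ρ : ℝ → ℝ → ℝ} (sol : WarpedBerger T f g ρ) :
    LS T (fun ξ t => Real.log (f ξ t)) (fun ξ t => Real.log (g ξ t)) ρ ∧
    (∀ ξ t, 0 ≤ t → t < T →
      Ds ρ f ξ t = f ξ t * Ds ρ (fun ξ t => Real.log (f ξ t)) ξ t ∧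
      Ds ρ g ξ t = g ξ t * Ds ρ (fun ξ t => Real.log (g ξ t)) ξ t ∧
      Ds ρ (Ds ρ f) ξ t = f ξ t * (Ds ρ (Ds ρ (fun ξ t => Real.log (f ξ t))) ξ t
        + (Ds ρ (fun ξ t => Real.log (f ξ t)) ξ t) ^ 2) ∧
      Ds ρ (Ds ρ g) ξ t = g ξ t * (Ds ρ (Ds ρ (fun ξ t => Real.log (g ξ t))) ξ t
        + (Ds ρ (fun ξ t => Real.log (g ξ t)) ξ t) ^ 2)) := by
  have sf : Sm T f := contDiff_fst.comp_contDiffOn sol.smooth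
  have sgr := contDiff_snd.comp_contDiffOn sol.smooth
  have sg : Sm T g := contDiff_fst.comp_contDiffOn sgr
  have sr : Sm T ρ := contDiff_snd.comp_contDiffOn sgr
  have slog : ∀ φ : ℝ → ℝ → ℝ, Sm T φ → (∀ ξ t : ℝ, 0 ≤ t → t < T → 0 < φ ξ t) →
      Sm T (fun ξ t => Real.log (φ ξ t)) := fun φ h hp =>
    ContDiffOn.log h (fun p hm => (hp p.1 p.2 hm.2.1 hm.2.2).ne')
  have r1 : ∀ φ : ℝ → ℝ → ℝ, Sm T φ → (∀ ξ t : ℝ, 0 ≤ t → t < T → 0 < φ ξ t) →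
      ∀ ξ t, 0 ≤ t → t < T → Ds ρ φ ξ t = φ ξ t * Ds ρ (fun ξ t => Real.log (φ ξ t)) ξ t := by
    intro φ h hp ξ t h0 hT
    have e := (hasDs sol.ρ_pos h (ξ := ξ) h0 hT).log (hp ξ t h0 hT).ne'
    have hφ := hp ξ t h0 hT
    have : Ds ρ (fun ξ t => Real.log (φ ξ t)) ξ t = Ds ρ φ ξ t / φ ξ t := by
      apply Ds_of (sol.ρ_pos ξ t h0 hT)
      refine HasDerivAt.congr_deriv e (by ring)
    rw [this]; field_simp
  have r2 : ∀ φ : ℝ → ℝ → ℝ, Sm T φ → (∀ ξ t : ℝ, 0 ≤ t → t < T → 0 < φ ξ t) →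
      ∀ ξ t, 0 ≤ t → t < T → Ds ρ (Ds ρ φ) ξ t =
        φ ξ t * (Ds ρ (Ds ρ (fun ξ t => Real.log (φ ξ t))) ξ t
        + (Ds ρ (fun ξ t => Real.log (φ ξ t)) ξ t) ^ 2) := by
    intro φ h hp ξ t h0 hT
    apply Ds_of (sol.ρ_pos ξ t h0 hT)
    rw [show (fun z => Ds ρ φ z t) = _ from funext (fun z => r1 φ h hp z t h0 hT)]
    have e := (hasDs sol.ρ_pos h (ξ := ξ) h0 hT).mul
      (hasDs sol.ρ_pos (Sm.Ds sr sol.ρ_pos (slog φ h hp)) (ξ := ξ) h0 hT)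
    refine HasDerivAt.congr_deriv e ?_
    rw [r1 φ h hp ξ t h0 hT]
    ring
  have tl : ∀ φ : ℝ → ℝ → ℝ, Sm T φ → (∀ ξ t : ℝ, 0 ≤ t → t < T → 0 < φ ξ t) →
      ∀ ξ t, 0 < t → t < T → pdt (fun ξ t => Real.log (φ ξ t)) ξ t = pdt φ ξ t / φ ξ t := by
    intro φ h hp ξ t h0 hT
    exact ((h.hasDt (ξ := ξ) h0 hT).log (hp ξ t h0.le hT).ne').deriv
  have hexp : ∀ ξ t, 0 ≤ t → t < T →
      Real.exp (2 * Real.log (f ξ t) - 4 * Real.log (g ξ t)) = f ξ t ^ 2 / g ξ t ^ 4 := by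
    intro ξ t h0 hT
    have a := sol.f_pos ξ t h0 hT
    have b := sol.g_pos ξ t h0 hT
    rw [Real.exp_sub]
    congr 1
    · rw [show (2 : ℝ) * Real.log (f ξ t) = (2 : ℕ) * Real.log (f ξ t) by norm_num,
        Real.exp_nat_mul, Real.exp_log a]
    · rw [show (4 : ℝ) * Real.log (g ξ t) = (4 : ℕ) * Real.log (g ξ t) by norm_num,
        Real.exp_nat_mul, Real.exp_log b]
  have hexq : ∀ ξ t, 0 ≤ t → t < T →
      Real.exp (-2 * Real.log (g ξ t)) = 1 / g ξ t ^ 2 := by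
    intro ξ t h0 hT
    have b := sol.g_pos ξ t h0 hT
    rw [show -2 * Real.log (g ξ t) = -((2 : ℕ) * Real.log (g ξ t)) by push_cast; ring, Real.exp_neg,
      Real.exp_nat_mul, Real.exp_log b, one_div]
  refine ⟨⟨sol.T_pos, sr, slog f sf sol.f_pos, slog g sg sol.g_pos, sol.ρ_pos, ?_, ?_, sol.ρ_per,
    ?_, ?_, ?_⟩, ?_⟩
  · intro ξ t; simp only [sol.f_per]
  · intro ξ t; simp only [sol.g_per]
  · intro ξ t h0 hT
    have a := sol.f_pos ξ t h0.le hT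
    have b := sol.g_pos ξ t h0.le hT
    rw [tl f sf sol.f_pos ξ t h0 hT, sol.eq_f ξ t h0 hT, hexp ξ t h0.le hT,
      r2 f sf sol.f_pos ξ t h0.le hT, r1 f sf sol.f_pos ξ t h0.le hT, r1 g sg sol.g_pos ξ t h0.le hT]
    field_simp
    ring
  · intro ξ t h0 hT
    have a := sol.f_pos ξ t h0.le hT
    have b := sol.g_pos ξ t h0.le hT
    rw [tl g sg sol.g_pos ξ t h0 hT, sol.eq_g ξ t h0 hT, hexp ξ t h0.le hT, hexq ξ t h0.le hT,
      r2 g sg sol.g_pos ξ t h0.le hT, r1 f sf sol.f_pos ξ t h0.le hT, r1 g sg sol.g_pos ξ t h0.le hT]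
    field_simp
    ring
  · intro ξ t h0 hT
    have a := sol.f_pos ξ t h0.le hT
    have b := sol.g_pos ξ t h0.le hT
    rw [sol.eq_ρ ξ t h0 hT, r2 g sg sol.g_pos ξ t h0.le hT, r2 f sf sol.f_pos ξ t h0.le hT]
    field_simp
    ring
  · intro ξ t h0 hT
    exact ⟨r1 f sf sol.f_pos ξ t h0 hT, r1 g sg sol.g_pos ξ t h0 hT,
      r2 f sf sol.f_pos ξ t h0 hT, r2 g sg sol.g_pos ξ t h0 hT⟩

set_option maxHeartbeats 1000000 in
lemma pointwise {T : ℝ} {f g ρ : ℝ → ℝ → ℝ} (sol : WarpedBerger T f g ρ)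
    (h_order : ∀ ξ : ℝ, f ξ 0 ≤ g ξ 0) :
    ∃ K, 0 ≤ K ∧ ∀ ξ t, 0 ≤ t → t < T →
      |k01 ρ f ξ t| ≤ K / g ξ t ^ 2 ∧ |k02 ρ g ξ t| ≤ K / g ξ t ^ 2 ∧
      |k12 ρ f g ξ t| ≤ K / g ξ t ^ 2 ∧ |k23 ρ f g ξ t| ≤ K / g ξ t ^ 2 := by
  obtain ⟨L, hr⟩ := sol.toLS
  have hi : ∀ ξ, Real.log (f ξ 0) ≤ Real.log (g ξ 0) := fun ξ =>
    Real.log_le_log (sol.f_pos ξ 0 le_rfl sol.T_pos) (h_order ξ)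
  obtain ⟨K, hK, hb⟩ := L.curv' hi
  refine ⟨2 * K + 7, by linarith, fun ξ t h0 hT => ?_⟩
  have a := sol.f_pos ξ t h0 hT
  have b := sol.g_pos ξ t h0 hT
  have hfg : f ξ t ≤ g ξ t := (Real.log_le_log_iff a b).mp (L.order hi ξ t h0 hT)
  obtain ⟨e1, e2, e3, e4⟩ := hr ξ t h0 hT
  obtain ⟨b1, b2, b3, b4⟩ := hb ξ t h0 hT
  have hexq : Real.exp (-2 * Real.log (g ξ t)) = 1 / g ξ t ^ 2 := by
    rw [show -2 * Real.log (g ξ t) = -((2 : ℕ) * Real.log (g ξ t)) by push_cast; ring, Real.exp_neg,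
      Real.exp_nat_mul, Real.exp_log b, one_div]
  rw [hexq] at b1 b2 b3 b4
  unfold k01 k02 k12 k23
  rw [e3, e4, e1, e2]
  generalize Ds ρ (Ds ρ (fun ξ t => Real.log (f ξ t))) ξ t = A at *
  generalize Ds ρ (Ds ρ (fun ξ t => Real.log (g ξ t))) ξ t = B at *
  generalize Ds ρ (fun ξ t => Real.log (f ξ t)) ξ t = p at *
  generalize Ds ρ (fun ξ t => Real.log (g ξ t)) ξ t = q at *
  generalize f ξ t = u at *
  generalize g ξ t = v at *
  have hQ : 0 < 1 / v ^ 2 := by positivity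
  have hP : u ^ 2 / v ^ 4 ≤ 1 / v ^ 2 := by
    rw [div_le_div_iff₀ (by positivity) (by positivity)]
    have : u ^ 2 ≤ v ^ 2 := by gcongr
    nlinarith [sq_nonneg v]
  have hP0 : 0 ≤ u ^ 2 / v ^ 4 := by positivity
  have f1 : -(u * (A + p ^ 2)) / u = -(A + p ^ 2) := by field_simp
  have f2 : -(v * (B + q ^ 2)) / v = -(B + q ^ 2) := by field_simp
  have f3 : u * p * (v * q) / (u * v) = p * q := by field_simp
  have f4 : (4 * v ^ 2 - 3 * u ^ 2) / v ^ 4 - (v * q) ^ 2 / v ^ 2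
      = 4 * (1 / v ^ 2) - 3 * (u ^ 2 / v ^ 4) - q ^ 2 := by field_simp
  have f5 : (2 * K + 7) / v ^ 2 = 2 * (K * (1 / v ^ 2)) + 7 * (1 / v ^ 2) := by field_simp
  rw [f1, f2, f3, f4, f5]
  generalize u ^ 2 / v ^ 4 = P at *
  generalize 1 / v ^ 2 = Q at *
  have hKQ : 0 ≤ K * Q := by positivity
  rw [abs_le] at b1 b2
  have := sq_nonneg p
  have := sq_nonneg q
  have := sq_nonneg (p - q)
  have := sq_nonneg (p + q)
  refine ⟨?_, ?_, ?_, ?_⟩ <;> rw [abs_le] <;> constructor <;> linarith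

lemma Mcheck_le {T : ℝ} {f g ρ : ℝ → ℝ → ℝ} (sol : WarpedBerger T f g ρ) (ξ t : ℝ)
    (h0 : 0 ≤ t) (hT : t < T) : Mcheck f g t ≤ g ξ t := by
  have : BddBelow (Set.range fun ξ => M f g ξ t) := by
    refine ⟨0, ?_⟩
    rintro _ ⟨z, rfl⟩
    exact (lt_min (sol.f_pos z t h0 hT) (sol.g_pos z t h0 hT)).le
  exact (ciInf_le this ξ).trans (min_le_right _ _)

lemma Mcheck_pos {T : ℝ} {f g ρ : ℝ → ℝ → ℝ} (sol : WarpedBerger T f g ρ) (t : ℝ)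
    (h0 : 0 ≤ t) (hT : t < T) : 0 < Mcheck f g t := by
  have sf : Sm T f := contDiff_fst.comp_contDiffOn sol.smooth
  have sg : Sm T g := contDiff_fst.comp_contDiffOn (contDiff_snd.comp_contDiffOn sol.smooth)
  have hc : Continuous (fun z => M f g z t) := by
    refine continuous_iff_continuousAt.mpr (fun z => ?_)
    exact (sf.hasDx h0 hT).continuousAt.min (sg.hasDx h0 hT).continuousAt
  have pp : (0 : ℝ) < 2 * π := by positivity
  obtain ⟨z, _, hz⟩ := (isCompact_Icc (a := (0 : ℝ)) (b := 2 * π)).exists_isMinOn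
    ⟨0, le_rfl, pp.le⟩ hc.continuousOn
  have hzp : 0 < M f g z t := lt_min (sol.f_pos z t h0 hT) (sol.g_pos z t h0 hT)
  refine lt_of_lt_of_le hzp (le_ciInf fun ξ => ?_)
  have hP : Function.Periodic (fun z => M f g z t) (2 * π) := fun z => by
    simp only [M, sol.f_per, sol.g_per]
  obtain ⟨w, hw, hwz⟩ := hP.exists_mem_Ico₀ pp ξ
  have hwz' : M f g ξ t = M f g w t := hwz
  rw [hwz']
  exact hz (show w ∈ Set.Icc (0 : ℝ) (2 * π) from ⟨hw.1, hw.2.le⟩)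

/-- Suppose `f ≤ g` and `(min_ξ R)(max_ξ g²) > −3` at `t = 0`, `T < ∞`,
and the Ricci curvature blows up at `T`.  Then `liminf_{t↗T} M̌(t) = 0` and the mixed
sectional curvatures satisfy `|κ₀₁| + 2|κ₀₂| ≤ C/M̌(t)²` for a uniform constant `C`. -/
theorem mixed_curvature_bound (T : ℝ) (f g ρ : ℝ → ℝ → ℝ)
    (sol : WarpedBerger T f g ρ)
    (h_order : ∀ ξ : ℝ, f ξ 0 ≤ g ξ 0)
    (h_scal : (⨅ ξ : ℝ, scalR ρ f g ξ 0) * (⨆ ξ : ℝ, (g ξ 0) ^ 2) > -3)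
    (h_blow : RicciBlowup T f g ρ) :
    Filter.liminf (fun t => Mcheck f g t) (𝓝[<] T) = 0 ∧
    ∃ C : ℝ, ∀ ξ t : ℝ, 0 ≤ t → t < T →
      |k01 ρ f ξ t| + 2 * |k02 ρ g ξ t| ≤ C / (Mcheck f g t) ^ 2 := by
  obtain ⟨K, hK, hb⟩ := pointwise sol h_order
  constructor
  · have hmem : Set.Ioo 0 T ∈ 𝓝[<] T := Ioo_mem_nhdsLT sol.T_pos
    have key : ∀ a : ℝ, (∀ᶠ t in 𝓝[<] T, a ≤ Mcheck f g t) → a ≤ 0 := by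
      intro a ha
      by_contra hcon
      push Not at hcon
      obtain ⟨l, hl, hsub⟩ := (mem_nhdsLT_iff_exists_Ioo_subset).mp (Filter.inter_mem ha hmem)
      obtain ⟨ξ, t, ht0, htT, hlt⟩ := h_blow (9 * (K / a ^ 2)) (max l 0) (le_max_right _ _)
        (max_lt hl sol.T_pos)
      have hl' : l < t := lt_of_le_of_lt (le_max_left _ _) ht0
      have h0 : 0 ≤ t := (le_max_right l 0).trans ht0.le
      have hat : a ≤ Mcheck f g t := (hsub ⟨hl', htT⟩).1
      have hag : a ≤ g ξ t := hat.trans (Mcheck_le sol ξ t h0 htT)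
      have hKa : K / g ξ t ^ 2 ≤ K / a ^ 2 := by gcongr
      have hKa0 : 0 ≤ K / a ^ 2 := by positivity
      obtain ⟨c1, c2, c3, c4⟩ := hb ξ t h0 htT
      have d1 := abs_add_le (k01 ρ f ξ t) (2 * k12 ρ f g ξ t)
      have d2 := abs_add_le (k01 ρ f ξ t) (2 * k02 ρ g ξ t)
      have d3 := abs_add_le (k02 ρ g ξ t + k12 ρ f g ξ t) (k23 ρ f g ξ t)
      have d4 := abs_add_le (k02 ρ g ξ t) (k12 ρ f g ξ t)
      have d5 : |2 * k12 ρ f g ξ t| = 2 * |k12 ρ f g ξ t| := by rw [abs_mul]; simp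
      have d6 : |2 * k02 ρ g ξ t| = 2 * |k02 ρ g ξ t| := by rw [abs_mul]; simp
      linarith
    have hzero : ∀ᶠ t in 𝓝[<] T, (0 : ℝ) ≤ Mcheck f g t := by
      filter_upwards [hmem] with t ht
      exact (Mcheck_pos sol t ht.1.le ht.2).le
    rw [Filter.liminf_eq]
    apply le_antisymm
    · exact csSup_le ⟨0, hzero⟩ (fun a ha => key a ha)
    · exact le_csSup ⟨0, fun a ha => key a ha⟩ hzero
  · refine ⟨3 * K, fun ξ t h0 hT => ?_⟩
    obtain ⟨c1, c2, _, _⟩ := hb ξ t h0 hT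
    have hm := Mcheck_pos sol t h0 hT
    have hle := Mcheck_le sol ξ t h0 hT
    have hKa : K / g ξ t ^ 2 ≤ K / Mcheck f g t ^ 2 := by gcongr
    have : 3 * K / Mcheck f g t ^ 2 = 3 * (K / Mcheck f g t ^ 2) := by ring
    rw [this]
    linarith
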